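/- Let n be a positive integer with n ≡ 5 (mod 6). Then ∑_{k=0}^{n−1} (q;q^6)_k (q;q^6)_k (q^4;q^6)_k · q^{6k} / (q^6;q^6)_k^3 ≡ 0 (mod Φ_n(q)^2), as rational functions of q over ℚ. -/

import Mathlib

open Finset Polynomial

/-- The q-shifted factorial `(x; q)_k = ∏_{j=0}^{k-1} (1 - x q^j)` in `RatFunc ℚ`. -/
noncomputable def qPoch (x q : RatFunc ℚ) (k : ℕ) : RatFunc ℚ :=
  ∏ j ∈ Finset.range k, (1 - x * q ^ j)

/-- `A ≡ 0 (mod P)`: `A = P · B` for some rational function `B` whose denominator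
(in lowest terms) is coprime to `P`. -/
def CongrZero (A : RatFunc ℚ) (P : Polynomial ℚ) : Prop :=
  ∃ B : RatFunc ℚ, A = algebraMap (Polynomial ℚ) (RatFunc ℚ) P * B ∧ IsCoprime B.denom P

section QSaalschutz

lemma qPoch_zero (w p : RatFunc ℚ) : qPoch w p 0 = 1 := by
  simp [qPoch]

lemma qPoch_succ (w p : RatFunc ℚ) (k : ℕ) :
    qPoch w p (k + 1) = qPoch w p k * (1 - w * p ^ k) :=
  Finset.prod_range_succ _ _

lemma qPoch_succ' (w p : RatFunc ℚ) (k : ℕ) :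
    qPoch w p (k + 1) = (1 - w) * qPoch (w * p) p k := by
  simp [qPoch, Finset.prod_range_succ', pow_succ', mul_assoc, mul_comm]

lemma qPoch_eq_zero {w p : RatFunc ℚ} {j k : ℕ} (hjk : j < k) (h : w * p ^ j = 1) :
    qPoch w p k = 0 :=
  Finset.prod_eq_zero (Finset.mem_range.2 hjk) (by rw [h, sub_self])

lemma qPoch_self_ne_zero {p : RatFunc ℚ} (hp : ∀ j : ℕ, p ^ (j + 1) ≠ 1) (k : ℕ) :
    qPoch p p k ≠ 0 :=
  Finset.prod_ne_zero_iff.2 fun j _ => sub_ne_zero.2 (by rw [← pow_succ']; exact (hp j).symm)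

/-- The summand of the terminating balanced `₃φ₂` series with upper parameters `x p ^ N`,
`p ^ (-N)`, `b`, lower parameters `p`, `p`, and base `p`. -/
noncomputable def saalTerm (x b p : RatFunc ℚ) (N k : ℕ) : RatFunc ℚ :=
  qPoch (x * p ^ N) p k * qPoch (p ^ N)⁻¹ p k * qPoch b p k * p ^ k / qPoch p p k ^ 3

lemma sum_saalTerm_telescope {x b p : RatFunc ℚ} (hp0 : p ≠ 0) (hp : ∀ j : ℕ, p ^ (j + 1) ≠ 1)
    (hxb : x * b = p) (N M : ℕ) :
    ∑ k ∈ range (M + 1), ((1 - p ^ (N + 1)) ^ 2 * saalTerm x b p (N + 1) k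
        - b * (1 - x * p ^ N) ^ 2 * saalTerm x b p N k)
      = (1 - x * p * (p ^ N) ^ 2) * qPoch (x * p ^ (N + 1)) p M * qPoch (p ^ N)⁻¹ p M
        * qPoch b p (M + 1) / qPoch p p M ^ 3 := by
  induction M with
  | zero =>
    simp only [zero_add, Finset.sum_range_one, saalTerm, qPoch_zero, qPoch_succ, pow_zero]
    subst hxb
    ring
  | succ k ih =>
    rw [Finset.sum_range_succ, ih]
    have hx : x ≠ 0 := by rintro rfl; simp at hxb; exact hp0 hxb.symm
    have hb : b ≠ 0 := by rintro rfl; simp at hxb; exact hp0 hxb.symm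
    have hD := qPoch_self_ne_zero hp k
    have hk : 1 - p * p ^ k ≠ 0 := sub_ne_zero.2 (by rw [← pow_succ']; exact (hp k).symm)
    have h1 : (p ^ (N + 1))⁻¹ * p = (p ^ N)⁻¹ := by
      rw [pow_succ, mul_inv, inv_mul_cancel_right₀ hp0]
    have h2 : x * p ^ N * p = x * p ^ (N + 1) := by ring
    have e1 : qPoch (x * p ^ N) p (k + 1) = (1 - x * p ^ N) * qPoch (x * p ^ (N + 1)) p k := by
      rw [qPoch_succ', h2]
    have e2 : qPoch (p ^ (N + 1))⁻¹ p (k + 1) = (1 - (p ^ (N + 1))⁻¹) * qPoch (p ^ N)⁻¹ p k := by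
      rw [qPoch_succ', h1]
    simp only [saalTerm, e1, e2, qPoch_succ b p (k + 1), qPoch_succ p p k,
      qPoch_succ (x * p ^ (N + 1)) p k, qPoch_succ (p ^ N)⁻¹ p k]
    have hP : p ^ N ≠ 0 := pow_ne_zero _ hp0
    simp only [pow_succ p]
    generalize p ^ N = P at *
    generalize p ^ k = y at *
    generalize qPoch p p k = D at *
    generalize qPoch (x * (P * p)) p k = T at *
    generalize qPoch P⁻¹ p k = U at *
    generalize qPoch b p (k + 1) = B at *
    clear ih e1 e2 h1 h2 hp
    subst hxb
    field_simp
    ring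

/-- A case of the `q`-Pfaff–Saalschütz summation. -/
lemma sum_saalTerm {x b p : RatFunc ℚ} (hp0 : p ≠ 0) (hp : ∀ j : ℕ, p ^ (j + 1) ≠ 1)
    (hxb : x * b = p) {N M : ℕ} (hNM : N < M) :
    ∑ k ∈ range M, saalTerm x b p N k = b ^ N * (qPoch x p N / qPoch p p N) ^ 2 := by
  induction N with
  | zero =>
    rw [Finset.sum_eq_single_of_mem 0 (Finset.mem_range.2 hNM)]
    · simp [saalTerm, qPoch_zero]
    · intro k _ hk
      have : qPoch (p ^ 0)⁻¹ p k = 0 := qPoch_eq_zero (Nat.pos_of_ne_zero hk) (by simp)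
      rw [saalTerm, this]
      simp
  | succ N ih =>
    obtain ⟨M, rfl⟩ : ∃ m, M = m + 1 := ⟨M - 1, by omega⟩
    have h := sum_saalTerm_telescope hp0 hp hxb N M
    have h0 : qPoch (p ^ N)⁻¹ p M = 0 :=
      qPoch_eq_zero (j := N) (by omega) (inv_mul_cancel₀ (pow_ne_zero _ hp0))
    rw [h0, Finset.sum_sub_distrib, ← Finset.mul_sum, ← Finset.mul_sum, ih (by omega)] at h
    have hD := qPoch_self_ne_zero hp N
    have hN : 1 - p * p ^ N ≠ 0 := sub_ne_zero.2 (by rw [← pow_succ']; exact (hp N).symm)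
    rw [qPoch_succ, qPoch_succ]
    apply mul_left_cancel₀ (pow_ne_zero 2 hN)
    rw [show (1 - p * p ^ N) ^ 2 * ∑ k ∈ range (M + 1), saalTerm x b p (N + 1) k
      = b * (1 - x * p ^ N) ^ 2 * (b ^ N * (qPoch x p N / qPoch p p N) ^ 2) by
        rw [← pow_succ' p]; linear_combination h]
    rw [mul_comm p] at hN ⊢
    field_simp
    ring

end QSaalschutz

section Congruence

/-- The rational functions whose denominator is coprime to `P`. -/
def regularSubring (P : ℚ[X]) : Subring (RatFunc ℚ) where
  carrier := {r | IsCoprime r.denom P}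
  mul_mem' {a b} ha hb :=
    (IsCoprime.mul_left (show IsCoprime a.denom P from ha) hb).of_isCoprime_of_dvd_left
      (RatFunc.denom_mul_dvd a b)
  one_mem' := by simp [isCoprime_one_left]
  add_mem' {a b} ha hb :=
    (IsCoprime.mul_left (show IsCoprime a.denom P from ha) hb).of_isCoprime_of_dvd_left
      (RatFunc.denom_add_dvd a b)
  zero_mem' := by simp [isCoprime_one_left]
  neg_mem' {a} ha := by
    have h := (IsCoprime.mul_left (show IsCoprime (RatFunc.denom (-1)) P by
      rw [← map_one (algebraMap ℚ[X] (RatFunc ℚ)), ← map_neg, RatFunc.denom_algebraMap]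
      exact isCoprime_one_left) (show IsCoprime a.denom P from ha)).of_isCoprime_of_dvd_left
      (RatFunc.denom_mul_dvd (-1) a)
    simpa using h

variable {P : ℚ[X]}

lemma algebraMap_mem_regularSubring (a : ℚ[X]) :
    algebraMap ℚ[X] (RatFunc ℚ) a ∈ regularSubring P := by
  change IsCoprime _ _
  rw [RatFunc.denom_algebraMap]
  exact isCoprime_one_left

lemma inv_algebraMap_mem_regularSubring {a : ℚ[X]} (ha : IsCoprime a P) :
    (algebraMap ℚ[X] (RatFunc ℚ) a)⁻¹ ∈ regularSubring P := by
  refine ha.of_isCoprime_of_dvd_left ?_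
  simpa using RatFunc.denom_div_dvd 1 a

lemma X_mem_regularSubring : RatFunc.X ∈ regularSubring P := by
  simpa using algebraMap_mem_regularSubring (P := P) X

lemma qPoch_mem_regularSubring {w p : RatFunc ℚ} (hw : w ∈ regularSubring P)
    (hp : p ∈ regularSubring P) (k : ℕ) : qPoch w p k ∈ regularSubring P :=
  prod_mem fun j _ => sub_mem (one_mem _) (mul_mem hw (pow_mem hp j))

lemma CongrZero.zero : CongrZero 0 P :=
  ⟨0, by simp, (regularSubring P).zero_mem⟩

lemma CongrZero.add {A B : RatFunc ℚ} (hA : CongrZero A P) (hB : CongrZero B P) :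
    CongrZero (A + B) P := by
  obtain ⟨a, rfl, ha⟩ := hA
  obtain ⟨b, rfl, hb⟩ := hB
  exact ⟨a + b, by ring, (regularSubring P).add_mem ha hb⟩

lemma CongrZero.mul_right {A r : RatFunc ℚ} (hA : CongrZero A P) (hr : r ∈ regularSubring P) :
    CongrZero (A * r) P := by
  obtain ⟨a, rfl, ha⟩ := hA
  exact ⟨a * r, by ring, (regularSubring P).mul_mem ha hr⟩

lemma CongrZero.sum {ι : Type*} {s : Finset ι} {f : ι → RatFunc ℚ}
    (h : ∀ i ∈ s, CongrZero (f i) P) : CongrZero (∑ i ∈ s, f i) P :=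
  Finset.sum_induction f (CongrZero · P) (fun _ _ => CongrZero.add) CongrZero.zero h

lemma CongrZero.of_dvd {a : ℚ[X]} (h : P ∣ a) : CongrZero (algebraMap ℚ[X] (RatFunc ℚ) a) P := by
  obtain ⟨c, rfl⟩ := h
  exact ⟨_, map_mul _ _ _, algebraMap_mem_regularSubring c⟩

lemma CongrZero.prod_sub_prod {f g : ℕ → RatFunc ℚ} (hf : ∀ i, f i ∈ regularSubring P)
    (hg : ∀ i, g i ∈ regularSubring P) (h : ∀ i, CongrZero (f i - g i) P) (k : ℕ) :
    CongrZero (∏ i ∈ range k, f i - ∏ i ∈ range k, g i) P := by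
  induction k with
  | zero => simpa using CongrZero.zero
  | succ k ih =>
    rw [Finset.prod_range_succ, Finset.prod_range_succ]
    convert (ih.mul_right (hf k)).add ((h k).mul_right (prod_mem fun i _ => hg i)) using 1
    ring

end Congruence

section Cyclotomic

lemma isCoprime_X_pow_sub_one_cyclotomic {m n : ℕ} (hm : 0 < m) (h : ¬ n ∣ m) :
    IsCoprime (X ^ m - 1 : ℚ[X]) (cyclotomic n ℚ) := by
  rw [← prod_cyclotomic_eq_X_pow_sub_one hm]
  refine IsCoprime.prod_left fun d hd => cyclotomic.isCoprime_rat ?_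
  rintro rfl
  exact h (Nat.dvd_of_mem_divisors hd)

lemma isCoprime_X_cyclotomic {n : ℕ} (hn : 0 < n) : IsCoprime (X : ℚ[X]) (cyclotomic n ℚ) := by
  obtain ⟨c, hc⟩ := cyclotomic.dvd_X_pow_sub_one n ℚ
  refine ⟨X ^ (n - 1), -c, ?_⟩
  obtain ⟨m, rfl⟩ : ∃ m, n = m + 1 := ⟨n - 1, by omega⟩
  simp only [Nat.add_sub_cancel]
  linear_combination hc

lemma cyclotomic_dvd_one_sub_X_pow (n c : ℕ) : cyclotomic n ℚ ∣ 1 - X ^ (c * n) := by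
  rw [← neg_sub, dvd_neg, mul_comm, pow_mul]
  exact (cyclotomic.dvd_X_pow_sub_one n ℚ).trans (sub_one_dvd_pow_sub_one _ c)

lemma RatFunc.X_pow_ne_one {m : ℕ} (hm : m ≠ 0) : (RatFunc.X : RatFunc ℚ) ^ m ≠ 1 := by
  rw [← RatFunc.algebraMap_X, ← map_pow, ← map_one (algebraMap ℚ[X] (RatFunc ℚ))]
  intro h
  have := congrArg natDegree (RatFunc.algebraMap_injective ℚ h)
  simp [hm] at this

lemma inv_qPoch_mem_regularSubring {n k : ℕ} (h6 : n.Coprime 6) (hk : k < n) :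
    (qPoch (RatFunc.X ^ 6) (RatFunc.X ^ 6) k)⁻¹ ∈ regularSubring (cyclotomic n ℚ ^ 2) := by
  rw [qPoch, ← Finset.prod_inv_distrib]
  refine prod_mem fun j hj => ?_
  have hj := Finset.mem_range.1 hj
  have : (1 - RatFunc.X ^ 6 * (RatFunc.X ^ 6) ^ j : RatFunc ℚ)
      = algebraMap ℚ[X] (RatFunc ℚ) (-(X ^ (6 * (j + 1)) - 1)) := by
    simp only [map_neg, map_sub, map_pow, map_one, RatFunc.algebraMap_X]
    ring
  rw [this]
  refine inv_algebraMap_mem_regularSubring (IsCoprime.neg_left (IsCoprime.pow_right ?_))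
  refine isCoprime_X_pow_sub_one_cyclotomic (by omega) fun hd => ?_
  exact absurd (Nat.le_of_dvd (by omega) (h6.dvd_of_dvd_mul_left hd)) (by omega)

end Cyclotomic

theorem stmt6 (n : ℕ) (hn : 0 < n) (hmod : n % 6 = 5) :
    CongrZero
      (∑ k ∈ Finset.range n,
        qPoch ((RatFunc.X : RatFunc ℚ) ^ (1 : ℤ)) (RatFunc.X ^ 6) k
            * qPoch ((RatFunc.X : RatFunc ℚ) ^ (1 : ℤ)) (RatFunc.X ^ 6) k
            * qPoch ((RatFunc.X : RatFunc ℚ) ^ (4 : ℤ)) (RatFunc.X ^ 6) k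
            * RatFunc.X ^ (6 * k)
          / (qPoch ((RatFunc.X : RatFunc ℚ) ^ 6) (RatFunc.X ^ 6) k) ^ 3)
      ((Polynomial.cyclotomic n ℚ) ^ 2) := by
  obtain ⟨m, rfl⟩ : ∃ m, n = 6 * m + 5 := ⟨n / 6, by omega⟩
  set n := 6 * m + 5 with hn_def
  set q : RatFunc ℚ := RatFunc.X with hq
  set N := 5 * m + 4 with hN
  have h6 : n.Coprime 6 := by
    rw [hn_def, add_comm, Nat.coprime_add_mul_left_left]
    decide
  have hq0 : q ≠ 0 := RatFunc.X_ne_zero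
  have hqmem : q ∈ regularSubring (cyclotomic n ℚ ^ 2) := X_mem_regularSubring
  have hqinv : q⁻¹ ∈ regularSubring (cyclotomic n ℚ ^ 2) := by
    rw [hq, ← RatFunc.algebraMap_X]
    exact inv_algebraMap_mem_regularSubring (isCoprime_X_cyclotomic hn).pow_right
  have hsq (c : ℕ) : CongrZero ((1 - q ^ (c * n)) ^ 2) (cyclotomic n ℚ ^ 2) := by
    have := CongrZero.of_dvd (pow_dvd_pow_of_dvd (cyclotomic_dvd_one_sub_X_pow n c) 2)
    simpa using this
  have hpairs (k : ℕ) : CongrZero (qPoch q (q ^ 6) k * qPoch q (q ^ 6) k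
      - qPoch (q ^ 2 * (q ^ 6) ^ N) (q ^ 6) k * qPoch ((q ^ 6) ^ N)⁻¹ (q ^ 6) k)
      (cyclotomic n ℚ ^ 2) := by
    simp only [qPoch, ← Finset.prod_mul_distrib]
    have hmem {w : RatFunc ℚ} (hw : w ∈ regularSubring (cyclotomic n ℚ ^ 2)) (i : ℕ) :
        1 - w * (q ^ 6) ^ i ∈ regularSubring (cyclotomic n ℚ ^ 2) :=
      sub_mem (one_mem _) (mul_mem hw (pow_mem (pow_mem hqmem _) _))
    refine CongrZero.prod_sub_prod (fun i => mul_mem (hmem hqmem i) (hmem hqmem i))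
      (fun i => mul_mem (hmem (mul_mem (pow_mem hqmem _) (pow_mem (pow_mem hqmem _) _)) i)
        (hmem ?_ i)) (fun i => ?_) k
    · rw [← inv_pow, ← inv_pow]
      exact pow_mem (pow_mem hqinv _) _
    · convert (hsq 5).mul_right (mul_mem (pow_mem hqmem (1 + 6 * i)) (pow_mem hqinv (5 * n)))
        using 1
      have e : q ^ (5 * n) = q * (q ^ 6) ^ N := by
        rw [← pow_mul, ← pow_succ']
        congr 1
        omega
      rw [inv_pow, e, pow_add, pow_mul]
      field_simp
      ring
  have hsaal := sum_saalTerm (x := q ^ 2) (b := q ^ 4) (p := q ^ 6) (pow_ne_zero _ hq0)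
    (fun j => by rw [← pow_mul]; exact RatFunc.X_pow_ne_one (by omega)) (by ring)
    (show N < n by omega)
  have hmain : CongrZero (∑ k ∈ range n, saalTerm (q ^ 2) (q ^ 4) (q ^ 6) N k)
      (cyclotomic n ℚ ^ 2) := by
    have hfac : qPoch (q ^ 2) (q ^ 6) N = (1 - q ^ (4 * n))
        * ∏ j ∈ (range N).erase (4 * m + 3), (1 - q ^ 2 * (q ^ 6) ^ j) := by
      rw [qPoch, ← Finset.mul_prod_erase _ _ (Finset.mem_range.2 (show 4 * m + 3 < N by omega)),
        show 4 * n = 2 + 6 * (4 * m + 3) by omega, pow_add q, pow_mul q]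
    rw [hsaal, hfac]
    convert (hsq 4).mul_right (mul_mem (pow_mem (pow_mem hqmem 4) N) (pow_mem (mul_mem
      (prod_mem fun j _ => sub_mem (one_mem _) (mul_mem (pow_mem hqmem 2)
        (pow_mem (pow_mem hqmem 6) j)))
      (inv_qPoch_mem_regularSubring h6 (show N < n by omega))) 2)) using 1
    rw [div_eq_mul_inv]
    ring
  have hdiff := CongrZero.sum (s := range n) fun k hk => (hpairs k).mul_right
    (mul_mem (mul_mem (qPoch_mem_regularSubring (pow_mem hqmem 4) (pow_mem hqmem 6) k)
      (pow_mem (pow_mem hqmem 6) k))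
      (pow_mem (inv_qPoch_mem_regularSubring h6 (Finset.mem_range.1 hk)) 3))
  convert hdiff.add hmain using 1
  rw [← Finset.sum_add_distrib]
  refine Finset.sum_congr rfl fun k _ => ?_
  have z4 : q ^ (4 : ℤ) = q ^ 4 := by norm_cast
  rw [zpow_one, z4, saalTerm, pow_mul, div_eq_mul_inv, div_eq_mul_inv, inv_pow]
  ring
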